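/- Let f : ℝ → ℝ be defined by f(z) = −2·log(1 + e^{−z/2}) and for integers m ≥ 0 let H_m(x) = ∫₀^∞ ℓ^{2m+1}( f(ℓ+x) − f(ℓ−x) ) dℓ. Then for all integers j, k ≥ 0 and every real L, ∫₀^∞ ∫₀^∞ ℓ^{2j+1} (ℓ')^{2k+1} ( f(ℓ + ℓ' + L) − f(ℓ + ℓ' − L) ) dℓ dℓ' = ( (2j+1)!·(2k+1)! / (2j+2k+3)! ) · H_{j+k+1}(L). -/

import Mathlib

noncomputable section

/-- Mirzakhani's function `f(z) = -2 log(1 + e^{-z/2})`. -/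
def fMirz (z : ℝ) : ℝ := -2 * Real.log (1 + Real.exp (-z / 2))

/-- The integral `H_m(x) = ∫₀^∞ ℓ^{2m+1} (f(ℓ+x) - f(ℓ-x)) dℓ`. -/
def Hfun (m : ℕ) (x : ℝ) : ℝ :=
  ∫ ℓ in Set.Ioi (0 : ℝ), ℓ ^ (2 * m + 1) * (fMirz (ℓ + x) - fMirz (ℓ - x))

open MeasureTheory Set in
theorem aux_beta (s : ℝ) (b : ℕ) : ∀ a : ℕ, (∫ y in (0:ℝ)..s, (s - y) ^ a * y ^ b)
    = ((a.factorial : ℝ) * (b.factorial : ℝ) / ((a + b + 1).factorial : ℝ)) * s ^ (a + b + 1) := by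
  induction b with
  | zero =>
    intro a
    have h := intervalIntegral.integral_comp_sub_left (a := 0) (b := s) (fun x : ℝ => x ^ a) s
    simp only [pow_zero, mul_one, add_zero, Nat.factorial_zero, Nat.cast_one]
    rw [h, sub_self, sub_zero, integral_pow, Nat.factorial_succ]
    have := Nat.factorial_ne_zero a
    push_cast
    field_simp
    simp
  | succ b ih =>
    intro a
    have h1 : ∀ y ∈ uIcc 0 s, HasDerivAt (fun y : ℝ => (s - y) ^ (a + 1) * y ^ (b + 1))
        (-((a:ℝ) + 1) * ((s - y) ^ a * y ^ (b + 1)) + ((b:ℝ) + 1) * ((s - y) ^ (a + 1) * y ^ b)) y := by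
      intro y _
      have e1 := ((hasDerivAt_id y).const_sub s).pow (a + 1)
      have e2 := (hasDerivAt_id y).pow (b + 1)
      have e3 := e1.mul e2
      refine HasDerivAt.congr_deriv (f := fun y : ℝ => (s - y) ^ (a + 1) * y ^ (b + 1)) e3 ?_
      simp
      ring
    have h2 := intervalIntegral.integral_eq_sub_of_hasDerivAt h1
      (Continuous.intervalIntegrable (by fun_prop) _ _)
    rw [intervalIntegral.integral_add (Continuous.intervalIntegrable (by fun_prop) _ _)
      (Continuous.intervalIntegrable (by fun_prop) _ _), intervalIntegral.integral_const_mul,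
      intervalIntegral.integral_const_mul, ih (a + 1)] at h2
    simp only [sub_self, ne_eq, Nat.add_eq_zero_iff, one_ne_zero, and_false, not_false_eq_true,
      zero_pow, zero_mul, mul_zero] at h2
    have e : a + 1 + b + 1 = a + (b + 1) + 1 := by ring
    rw [e] at h2
    have h3 : ((a:ℝ) + 1) * (∫ y in (0:ℝ)..s, (s - y) ^ a * y ^ (b + 1)) =
      ((b:ℝ) + 1) * ((((a + 1).factorial : ℝ) * (b.factorial : ℝ) / ((a + (b + 1) + 1).factorial : ℝ)) * s ^ (a + (b + 1) + 1)) := by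
      linarith
    have h4 : ((a:ℝ) + 1) ≠ 0 := by positivity
    apply mul_left_cancel₀ h4
    rw [h3, Nat.factorial_succ a, Nat.factorial_succ b]
    push_cast
    ring

theorem aux_f_bound (z : ℝ) : |fMirz z| ≤ 2 * Real.exp (-z / 2) := by
  unfold fMirz
  have h := Real.exp_pos (-z / 2)
  have h1 := Real.log_le_sub_one_of_pos (show 0 < 1 + Real.exp (-z / 2) by linarith)
  have h2 := Real.log_nonneg (show 1 ≤ 1 + Real.exp (-z / 2) by linarith)
  rw [abs_le]
  constructor <;> linarith

theorem aux_f_cont : Continuous fMirz := by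
  unfold fMirz
  refine continuous_const.mul (Continuous.log (by fun_prop) ?_)
  intro x
  have h := Real.exp_pos (-x / 2)
  linarith

theorem aux_g_bound (L s : ℝ) : |fMirz (s + L) - fMirz (s - L)| ≤
    (2 * Real.exp (-L / 2) + 2 * Real.exp (L / 2)) * Real.exp (-s / 2) := by
  have h1 := aux_f_bound (s + L)
  have h2 := aux_f_bound (s - L)
  have h3 := abs_sub (fMirz (s + L)) (fMirz (s - L))
  have e1 : Real.exp (-(s + L) / 2) = Real.exp (-L / 2) * Real.exp (-s / 2) := by
    rw [← Real.exp_add]; ring_nf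
  have e2 : Real.exp (-(s - L) / 2) = Real.exp (L / 2) * Real.exp (-s / 2) := by
    rw [← Real.exp_add]; ring_nf
  rw [e1] at h1
  rw [e2] at h2
  linarith

open MeasureTheory Set in
theorem aux_h_int (a : ℕ) :
    Integrable (indicator (Ioi (0:ℝ)) (fun x => x ^ a * Real.exp (-x / 2))) := by
  rw [integrable_indicator_iff measurableSet_Ioi]
  have h := integrableOn_rpow_mul_exp_neg_mul_rpow (p := 1) (s := a) (b := 1/2)
    (by have : (0:ℝ) ≤ a := by positivity
        linarith) (by norm_num) (by norm_num)
  refine h.congr_fun ?_ measurableSet_Ioi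
  intro x hx
  simp only [Real.rpow_natCast, Real.rpow_one]
  ring_nf

open MeasureTheory Set in
theorem aux_main (a b : ℕ) (g : ℝ → ℝ) (hg : Continuous g) (C : ℝ)
    (hC : ∀ s, |g s| ≤ C * Real.exp (-s / 2)) :
    (∫ y in Ioi (0:ℝ), ∫ x in Ioi (0:ℝ), x ^ a * y ^ b * g (x + y)) =
    ((a.factorial : ℝ) * (b.factorial : ℝ) / ((a + b + 1).factorial : ℝ)) *
      ∫ s in Ioi (0:ℝ), s ^ (a + b + 1) * g s := by
  set p : ℕ → ℝ → ℝ := fun n => indicator (Ioi (0:ℝ)) (fun x => x ^ n) with hp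
  have hpm : ∀ n, Measurable (p n) := fun n =>
    (measurable_id.pow_const n).indicator measurableSet_Ioi
  have hint : Integrable (fun q : ℝ × ℝ => p a (q.1 - q.2) * p b q.2 * g q.1)
      (volume.prod volume) := by
    have h := Integrable.convolution_integrand (μ := volume) (ν := volume)
      (ContinuousLinearMap.mul ℝ ℝ) (aux_h_int b) (aux_h_int a)
    refine (h.const_mul C).mono' ?_ (Filter.Eventually.of_forall ?_)
    · apply Measurable.aestronglyMeasurable
      exact (((hpm a).comp (measurable_fst.sub measurable_snd)).mul
        ((hpm b).comp measurable_snd)).mul (hg.measurable.comp measurable_fst)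
    · rintro ⟨s, y⟩
      simp only [hp, ContinuousLinearMap.mul_apply', indicator, mem_Ioi]
      by_cases h1 : 0 < y <;> by_cases h2 : 0 < s - y <;> simp only [h1, h2, if_true, if_false,
        mul_zero, zero_mul, norm_zero, le_refl]
      rw [norm_mul, Real.norm_of_nonneg (by positivity), Real.norm_eq_abs]
      have e : Real.exp (-s / 2) = Real.exp (-y / 2) * Real.exp (-(s - y) / 2) := by
        rw [← Real.exp_add]; ring_nf
      have h3 := hC s
      rw [e] at h3
      calc _ ≤ _ := mul_le_mul_of_nonneg_left h3 (show 0 ≤ (s - y) ^ a * y ^ b by positivity)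
        _ = _ := by ring
  have hL : (∫ y in Ioi (0:ℝ), ∫ x in Ioi (0:ℝ), x ^ a * y ^ b * g (x + y)) =
      ∫ y, ∫ s, p a (s - y) * p b y * g s := by
    rw [← integral_indicator measurableSet_Ioi]
    congr 1
    ext y
    have h := integral_sub_right_eq_self (μ := volume) (fun x => p a x * p b y * g (x + y)) y
    simp only [sub_add_cancel] at h
    rw [h]
    by_cases hy : y ∈ Ioi (0:ℝ)
    · rw [indicator_of_mem hy, ← integral_indicator measurableSet_Ioi]
      congr 1
      ext x
      by_cases hx : x ∈ Ioi (0:ℝ)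
      · simp only [hp, indicator_of_mem hx, indicator_of_mem hy]
      · simp only [hp, indicator_of_notMem hx, zero_mul]
    · rw [indicator_of_notMem hy]
      simp only [hp, indicator_of_notMem hy, zero_mul, mul_zero, integral_zero]
  rw [hL, ← integral_integral_swap (f := fun s y => p a (s - y) * p b y * g s) hint,
    ← integral_const_mul, ← integral_indicator measurableSet_Ioi]
  congr 1
  ext s
  rw [integral_mul_const]
  by_cases hs : s ∈ Ioi (0:ℝ)
  · rw [indicator_of_mem hs, ← mul_assoc, ← aux_beta s b a,
      intervalIntegral.integral_of_le (le_of_lt hs), integral_Ioc_eq_integral_Ioo,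
      ← integral_indicator measurableSet_Ioo]
    congr 2
    ext y
    simp only [hp, indicator, mem_Ioi, mem_Ioo, sub_pos]
    by_cases h1 : 0 < y <;> by_cases h2 : y < s <;> simp [h1, h2]
  · rw [indicator_of_notMem hs]
    have : ∀ y, p a (s - y) * p b y = 0 := by
      intro y
      simp only [hp, indicator, mem_Ioi, sub_pos] at hs ⊢
      by_cases h1 : 0 < y
      · rw [if_neg (by linarith), zero_mul]
      · rw [if_neg h1, mul_zero]
    simp [this]

/-- The double integral against Mirzakhani's kernel:
`∫₀^∞ ∫₀^∞ ℓ^{2j+1} ℓ'^{2k+1} (f(ℓ+ℓ'+L) - f(ℓ+ℓ'-L)) dℓ dℓ'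
  = ((2j+1)!(2k+1)!/(2j+2k+3)!) H_{j+k+1}(L)`. -/
theorem double_integral_formula (j k : ℕ) (L : ℝ) :
    (∫ ℓ' in Set.Ioi (0 : ℝ), ∫ ℓ in Set.Ioi (0 : ℝ),
        ℓ ^ (2 * j + 1) * ℓ' ^ (2 * k + 1) * (fMirz (ℓ + ℓ' + L) - fMirz (ℓ + ℓ' - L)))
      = (((2 * j + 1).factorial : ℝ) * ((2 * k + 1).factorial : ℝ)
          / ((2 * j + 2 * k + 3).factorial : ℝ)) * Hfun (j + k + 1) L := by
  have h := aux_main (2 * j + 1) (2 * k + 1) (fun s => fMirz (s + L) - fMirz (s - L))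
    ((aux_f_cont.comp (by fun_prop)).sub (aux_f_cont.comp (by fun_prop))) _ (aux_g_bound L)
  have e1 : 2 * j + 1 + (2 * k + 1) + 1 = 2 * j + 2 * k + 3 := by ring
  have e2 : 2 * (j + k + 1) + 1 = 2 * j + 2 * k + 3 := by ring
  rw [e1] at h
  unfold Hfun
  rw [e2]
  exact h

end
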